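/- Let t ∈ ℂ and let a(t) be the symmetric tensor of the binary cubic tY³ − 2t²Y²X − 9YX² + 2tX³ (the polynomial representing the multiplication ⨀³𝔫/𝔪𝔫 → 𝔫³ in the moduli algebra of the Ẽ₈ singularity x⁶+tx⁴y+y³+z²=0, with dual basis Y, X corresponding to y, x²). Then, with J = J(a(t)), K = K(a(t)), L = L(a(t)), one has the identity J·K²·(4t³ + 27) = 4t³·L³ for all t ∈ ℂ; in particular for 4t³+27 ≠ 0 and L ≠ 0, JK²/L³ = 4t³/(4t³+27), recovering Saito's j-invariant of Ẽ₈. -/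

import Mathlib

noncomputable section
open Finset

/-- The antisymmetric symbol on two indices with `ε^{12} = 1 = −ε^{21}`
(indices `0,1` in `Fin 2`). -/
def eps2 : Fin 2 → Fin 2 → ℂ := fun i j =>
  if (i, j) = (0, 1) then 1 else if (i, j) = (1, 0) then -1 else 0

/-- The partial contraction `c_i^j = Σ a_{ipq} ε^{jk} ε^{pl} ε^{qm} a_{klm}` of
a binary cubic tensor. -/
def cC (a : Fin 2 → Fin 2 → Fin 2 → ℂ) (i j : Fin 2) : ℂ :=
  ∑ p : Fin 2, ∑ q : Fin 2, ∑ k : Fin 2, ∑ l : Fin 2, ∑ m : Fin 2,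
    a i p q * eps2 j k * eps2 p l * eps2 q m * a k l m

/-- The degree-4 `SL(2,ℂ)`-invariant `J = Σ c_i^j c_j^i` of a binary cubic,
proportional to the discriminant. -/
def JC (a : Fin 2 → Fin 2 → Fin 2 → ℂ) : ℂ :=
  ∑ i : Fin 2, ∑ j : Fin 2, cC a i j * cC a j i

/-- The covector `e = (1,0)`, preserved up to scale by upper triangular
matrices. -/
def eC : Fin 2 → ℂ := fun i => if i = 0 then 1 else 0

/-- The degree-1 invariant `K = Σ a_{ijk} e^i e^j e^k` (the coefficient of `X³`). -/
def KC (a : Fin 2 → Fin 2 → Fin 2 → ℂ) : ℂ :=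
  ∑ i : Fin 2, ∑ j : Fin 2, ∑ k : Fin 2, a i j k * eC i * eC j * eC k

/-- The degree-2 invariant `L = Σ a_{ijk} a_{lmn} ε^{il} ε^{jm} e^k e^n`. -/
def LC (a : Fin 2 → Fin 2 → Fin 2 → ℂ) : ℂ :=
  ∑ i : Fin 2, ∑ j : Fin 2, ∑ k : Fin 2, ∑ l : Fin 2, ∑ m : Fin 2, ∑ n : Fin 2,
    a i j k * a l m n * eps2 i l * eps2 j m * eC k * eC n

/-- The symmetric tensor of the binary cubic `tY³ − 2t²Y²X − 9YX² + 2tX³`, the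
polynomial representing the multiplication `⨀³𝔫/𝔪𝔫 → 𝔫³` in the moduli algebra
of the `Ẽ₈` singularity `x⁶+tx⁴y+y³+z²=0` (`X` corresponds to index `0`, `Y`
to index `1`). -/
def aC (t : ℂ) : Fin 2 → Fin 2 → Fin 2 → ℂ := fun i j k =>
  if i.val + j.val + k.val = 0 then 2 * t
  else if i.val + j.val + k.val = 1 then -9 / 3
  else if i.val + j.val + k.val = 2 then -(2 * t ^ 2) / 3
  else t

/-- The value of `J` on the cubic `aC t`. -/
lemma JC_aC (t : ℂ) : JC (aC t) = -(8 / 27) * t * (4 * t ^ 3 + 27) ^ 2 := by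
  simp [JC, cC, aC, eps2, Fin.sum_univ_two]
  ring

/-- The value of `K` on the cubic `aC t`. -/
lemma KC_aC (t : ℂ) : KC (aC t) = 2 * t := by
  simp [KC, aC, eC]

/-- The value of `L` on the cubic `aC t`. -/
lemma LC_aC (t : ℂ) : LC (aC t) = -(2 / 3) * (4 * t ^ 3 + 27) := by
  simp [LC, aC, eC, eps2, Fin.sum_univ_two]
  ring

/-- For the binary cubic `tY³ − 2t²Y²X − 9YX² + 2tX³` one has
`JK²(4t³ + 27) = 4t³L³`; in particular for `4t³+27 ≠ 0` and `L ≠ 0`,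
`JK²/L³ = 4t³/(4t³+27)`, recovering Saito's `j`-invariant of `Ẽ₈`. -/
theorem statement17 (t : ℂ) :
    JC (aC t) * KC (aC t) ^ 2 * (4 * t ^ 3 + 27) = 4 * t ^ 3 * LC (aC t) ^ 3
      ∧ (4 * t ^ 3 + 27 ≠ 0 → LC (aC t) ≠ 0 →
          JC (aC t) * KC (aC t) ^ 2 / LC (aC t) ^ 3 = 4 * t ^ 3 / (4 * t ^ 3 + 27)) := by
  have key : JC (aC t) * KC (aC t) ^ 2 * (4 * t ^ 3 + 27) = 4 * t ^ 3 * LC (aC t) ^ 3 := by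
    rw [JC_aC, KC_aC, LC_aC]
    ring
  exact ⟨key, fun hP hL => (div_eq_div_iff (pow_ne_zero 3 hL) hP).2 key⟩
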